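/- Let M be the adjacency matrix of the oriented Dutch windmill graph D^m_n. Then M^(2n-1) = m · M^(n-1). -/

import Mathlib

/-- Edge relation of the oriented Dutch windmill graph `D^m_n`, on vertex
labels `1, …, m*(n-1)+1`. -/
def windmillEdge (m n a b : ℕ) : Prop :=
  (∃ k, 1 ≤ k ∧ k ≤ m ∧ a = 1 ∧ b = (k-1)*(n-1)+2) ∨
  (∃ k i, 1 ≤ k ∧ k ≤ m ∧ 2 ≤ i ∧ i ≤ n-1 ∧ a = (k-1)*(n-1)+i ∧ b = a+1) ∨
  (∃ k, 1 ≤ k ∧ k ≤ m ∧ a = (k-1)*(n-1)+n ∧ b = 1)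

/-- `IsWalk m n r w i j` : `w` is a walk of length `r` from `i` to `j` in `D^m_n`,
recorded as the sequence of its `r+1` vertices. -/
def IsWalk (m n r : ℕ) (w : Fin (r+1) → ℕ) (i j : ℕ) : Prop :=
  w 0 = i ∧ w (Fin.last r) = j ∧
  (∀ t : Fin (r+1), 1 ≤ w t ∧ w t ≤ m*(n-1)+1) ∧
  (∀ t : Fin r, windmillEdge m n (w t.castSucc) (w t.succ))

/-- Number of walks of length `r` from `i` to `j` in `D^m_n`. -/
noncomputable def numWalks (m n r i j : ℕ) : ℕ :=
  Nat.card {w : Fin (r+1) → ℕ // IsWalk m n r w i j}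

open Classical in
/-- Adjacency matrix of `D^m_n` (vertex `v : Fin (m*(n-1)+1)` has label `v+1`). -/
noncomputable def windmillMatrix (m n : ℕ) :
    Matrix (Fin (m*(n-1)+1)) (Fin (m*(n-1)+1)) ℝ :=
  fun i j => if windmillEdge m n ((i : ℕ)+1) ((j : ℕ)+1) then 1 else 0

open Classical in
/-- The windmill matrix, reindexed by `N = n - 1`. -/
noncomputable def wmM (m N : ℕ) : Matrix (Fin (m * N + 1)) (Fin (m * N + 1)) ℝ :=
  fun i j => if windmillEdge m (N + 1) ((i : ℕ) + 1) ((j : ℕ) + 1) then 1 else 0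

open Classical in
theorem wmM_apply (m N : ℕ) (i j : Fin (m * N + 1)) :
    wmM m N i j = if windmillEdge m (N + 1) ((i : ℕ) + 1) ((j : ℕ) + 1) then 1 else 0 := rfl

theorem wm_uniq {N k k' x y : ℕ} (hx : x < N) (hy : y < N) (h : k * N + x = k' * N + y) :
    k = k' ∧ x = y := by
  have h1 : k = k' := by
    rcases lt_trichotomy k k' with hlt | heq | hgt
    · have := Nat.mul_le_mul_right N (Nat.succ_le_of_lt hlt)
      rw [Nat.succ_mul] at this
      omega
    · exact heq
    · have := Nat.mul_le_mul_right N (Nat.succ_le_of_lt hgt)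
      rw [Nat.succ_mul] at this
      omega
  subst h1
  exact ⟨rfl, by omega⟩

theorem wm_edge_mid {m N k p b : ℕ} (hk : k < m) (hp : p + 1 < N) :
    windmillEdge m (N + 1) (k * N + p + 1 + 1) b ↔ b = k * N + p + 1 + 1 + 1 := by
  constructor
  · rintro (⟨k', h1, h2, h3, h4⟩ | ⟨k', i, h1, h2, h3, h4, h5, h6⟩ | ⟨k', h1, h2, h3, h4⟩)
    · omega
    · exact h6
    · exfalso
      simp only [Nat.add_sub_cancel] at h3
      obtain ⟨k', rfl⟩ : ∃ q, k' = q + 1 := ⟨k' - 1, by omega⟩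
      simp only [Nat.add_sub_cancel] at h3
      have := @wm_uniq N k (k' + 1) (p + 1) 0 (by omega) (by omega) (by rw [Nat.succ_mul]; omega)
      omega
  · intro h
    exact Or.inr (Or.inl ⟨k + 1, p + 2, by omega, by omega, by omega, by simp only [Nat.add_sub_cancel]; omega,
      by simp only [Nat.add_sub_cancel]; omega, h⟩)

theorem wm_edge_end {m N k b : ℕ} (hk : k < m) (hN : 2 ≤ N) :
    windmillEdge m (N + 1) (k * N + N + 1) b ↔ b = 1 := by
  constructor
  · rintro (⟨k', h1, h2, h3, h4⟩ | ⟨k', i, h1, h2, h3, h4, h5, h6⟩ | ⟨k', h1, h2, h3, h4⟩)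
    · omega
    · exfalso
      simp only [Nat.add_sub_cancel] at h5 h4
      have := @wm_uniq N (k + 1) (k' - 1) 0 (i - 1) (by omega) (by omega)
        (by rw [Nat.succ_mul]; omega)
      omega
    · exact h4
  · intro h
    exact Or.inr (Or.inr ⟨k + 1, by omega, by omega,
      by simp only [Nat.add_sub_cancel]; omega, h⟩)

theorem wm_edge_zero {m N b : ℕ} (hN : 2 ≤ N) :
    windmillEdge m (N + 1) (0 + 1) (b + 1) ↔ ∃ k < m, b = k * N + 1 := by
  constructor
  · rintro (⟨k', h1, h2, h3, h4⟩ | ⟨k', i, h1, h2, h3, h4, h5, h6⟩ | ⟨k', h1, h2, h3, h4⟩)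
    · simp only [Nat.add_sub_cancel] at h4
      exact ⟨k' - 1, by omega, by omega⟩
    · omega
    · omega
  · rintro ⟨k, hk, h⟩
    exact Or.inl ⟨k + 1, by omega, by omega, rfl, by simp only [Nat.add_sub_cancel]; omega⟩

theorem wm_lt {m N k p : ℕ} (hk : k < m) (hp : p < N) : k * N + p + 1 < m * N + 1 := by
  have := Nat.mul_le_mul_right N (Nat.succ_le_of_lt hk)
  rw [Nat.succ_mul] at this
  omega

/-- Walking out of a blade. -/
theorem wm_blade {m N : ℕ} (hN : 2 ≤ N) (k : ℕ) (hk : k < m) (a : ℕ) (j : Fin (m * N + 1)) :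
    ∀ d p : ℕ, ∀ h : k * N + p + 1 < m * N + 1, p + (d + 1) = N →
      (wmM m N ^ (a + (d + 1))) ⟨k * N + p + 1, h⟩ j
        = (wmM m N ^ a) (⟨0, by omega⟩ : Fin (m * N + 1)) j := by
  intro d
  induction d with
  | zero =>
    intro p h hp
    rw [show a + (0 + 1) = a + 1 from rfl, pow_succ', Matrix.mul_apply,
      Finset.sum_eq_single (⟨0, by omega⟩ : Fin (m * N + 1))]
    · have : wmM m N ⟨k * N + p + 1, h⟩ (⟨0, by omega⟩ : Fin (m * N + 1)) = 1 := by
        rw [wmM_apply]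
        rw [if_pos]
        have := (wm_edge_end (m := m) (b := 1) hk hN).2 rfl
        rw [show k * N + N + 1 = k * N + p + 1 + 1 by omega] at this
        exact this
      rw [this, one_mul]
    · intro b _ hb
      have : wmM m N ⟨k * N + p + 1, h⟩ b = 0 := by
        rw [wmM_apply]
        rw [if_neg]
        intro hc
        have e : k * N + p + 1 + 1 = k * N + N + 1 := by omega
        simp only [e] at hc
        rw [wm_edge_end hk hN] at hc
        apply hb
        apply Fin.ext
        simpa using hc
      rw [this, zero_mul]
    · simp
  | succ d ih =>
    intro p h hp
    have h' : k * N + (p + 1) + 1 < m * N + 1 := wm_lt hk (by omega)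
    rw [← ih (p + 1) h' (by omega), show a + (d + 1 + 1) = (a + (d + 1)) + 1 from rfl, pow_succ',
      Matrix.mul_apply, Finset.sum_eq_single (⟨k * N + (p + 1) + 1, h'⟩ : Fin (m * N + 1))]
    · have : wmM m N ⟨k * N + p + 1, h⟩
          (⟨k * N + (p + 1) + 1, h'⟩ : Fin (m * N + 1)) = 1 := by
        rw [wmM_apply]
        rw [if_pos]
        exact (wm_edge_mid hk (by omega)).2 (by simp only []; omega)
      rw [this, one_mul]
    · intro b _ hb
      have : wmM m N ⟨k * N + p + 1, h⟩ b = 0 := by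
        rw [wmM_apply]
        rw [if_neg]
        intro hc
        have hc := (wm_edge_mid hk (by omega)).1 hc
        apply hb
        apply Fin.ext
        simp only []
        omega
      rw [this, zero_mul]
    · simp

theorem wm_center {m N : ℕ} (hN : 2 ≤ N) (a : ℕ) (j : Fin (m * N + 1)) :
    (wmM m N ^ (a + N + 1)) (⟨0, by omega⟩ : Fin (m * N + 1)) j
      = m * (wmM m N ^ a) (⟨0, by omega⟩ : Fin (m * N + 1)) j := by
  classical
  rw [pow_succ', Matrix.mul_apply]
  let f : Fin m → Fin (m * N + 1) := fun k => ⟨k * N + 0 + 1, wm_lt k.2 (by omega)⟩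
  have hf : Function.Injective f := by
    intro x y hxy
    have := congrArg Fin.val hxy
    simp only [f] at this
    exact Fin.ext (@wm_uniq N x y 0 0 (by omega) (by omega) (by omega)).1
  have key : ∀ l : Fin (m * N + 1), l ∉ Finset.univ.image f →
      wmM m N (⟨0, by omega⟩ : Fin (m * N + 1)) l = 0 := by
    intro l hl
    rw [wmM_apply]
    rw [if_neg]
    intro hc
    obtain ⟨k, hk, h⟩ := (wm_edge_zero hN).1 hc
    exact hl (Finset.mem_image.2 ⟨⟨k, hk⟩, Finset.mem_univ _, Fin.ext (by simp [f, h])⟩)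
  have hs := Finset.sum_subset (Finset.subset_univ (Finset.univ.image f))
    (f := fun l => wmM m N (⟨0, by omega⟩ : Fin (m * N + 1)) l *
      (wmM m N ^ (a + N)) l j)
    (fun l _ hl => by rw [key l hl, zero_mul])
  refine hs.symm.trans ?_
  rw [Finset.sum_image (fun x _ y _ h => hf h)]
  have : ∀ k : Fin m, wmM m N (⟨0, by omega⟩ : Fin (m * N + 1)) (f k) *
      (wmM m N ^ (a + N)) (f k) j
      = (wmM m N ^ a) (⟨0, by omega⟩ : Fin (m * N + 1)) j := by
    intro k
    have h1 : wmM m N (⟨0, by omega⟩ : Fin (m * N + 1)) (f k) = 1 := by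
      rw [wmM_apply]
      rw [if_pos]
      exact (wm_edge_zero hN).2 ⟨k, k.2, by simp [f]⟩
    have h2 := wm_blade hN k k.2 a j (N - 1) 0 (f k).2 (by omega)
    rw [Nat.sub_add_cancel (by omega)] at h2
    rw [h1, one_mul]
    exact h2
  rw [Finset.sum_congr rfl (fun k _ => this k)]
  simp

theorem wm_main {m N : ℕ} (hN : 2 ≤ N) (i j : Fin (m * N + 1)) :
    (wmM m N ^ (N + N + 1)) i j = m * (wmM m N ^ N) i j := by
  obtain ⟨i, hi⟩ := i
  rcases Nat.eq_zero_or_pos i with h0 | h0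
  · subst h0
    exact wm_center hN N j
  · have hk : (i - 1) / N < m := by
      rw [Nat.div_lt_iff_lt_mul (by omega)]
      omega
    have hp : (i - 1) % N < N := Nat.mod_lt _ (by omega)
    have he : i = (i - 1) / N * N + (i - 1) % N + 1 := by
      have := Nat.div_add_mod' (i - 1) N
      omega
    generalize (i - 1) / N = k at *
    generalize (i - 1) % N = p at *
    subst he
    have e1 : N + N + 1 = (p + N + 1) + ((N - 1 - p) + 1) := by omega
    have e2 := wm_blade hN k hk (p + N + 1) j (N - 1 - p) p hi (by omega)
    have e3 := wm_blade hN k hk p j (N - 1 - p) p hi (by omega)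
    rw [← e1, wm_center hN] at e2
    rw [show p + ((N - 1 - p) + 1) = N by omega] at e3
    exact e2.trans (by rw [← e3])

theorem windmillMatrix_pow_two_n_minus_one (m n : ℕ) (hm : 1 ≤ m) (hn : 3 ≤ n) :
    (windmillMatrix m n)^(2*n-1) = (m : ℝ) • (windmillMatrix m n)^(n-1) := by
  obtain ⟨N, rfl⟩ : ∃ N, n = N + 1 := ⟨n - 1, by omega⟩
  have e : 2 * (N + 1) - 1 = N + N + 1 := by omega
  rw [e]
  ext i j
  rw [Matrix.smul_apply, smul_eq_mul]
  exact wm_main (by omega) i j
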